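/- Let A be a random variable satisfying Assumption (A3) with parameters κ > 0, θ ∈ (0,1) and h > 0, and let X be a random variable independent of A such that ∫₀^∞ y^{κ+δ−1} |P(X > y) − P(AX > y)| dy < ∞ for some δ > 0. Then there exists a function q ∈ 𝒬(κ,h) such that for every continuity point x > 0 of q, lim_{n→∞} p_n^{−1} x^κ e^{κnh} P(X > x e^{nh}) = q(x), where p_n = F_κ(nh) − F_κ(nh−). -/

import Mathlib

open MeasureTheory ProbabilityTheory Filter Topology

noncomputable section

/-- `q ∈ 𝒬(κ,h)`: `q : (0,∞) → [0,∞)`, `x ↦ x^{-κ} q(x)` is nonincreasing on `(0,∞)`,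
and `q(x e^h) = q(x)` for all `x > 0`. -/
def MemQ (κ h : ℝ) (q : ℝ → ℝ) : Prop :=
  (∀ x : ℝ, 0 < x → 0 ≤ q x) ∧
  AntitoneOn (fun x : ℝ => x ^ (-κ) * q x) (Set.Ioi (0 : ℝ)) ∧
  (∀ x : ℝ, 0 < x → q (x * Real.exp h) = q x)

/-- The conditional distribution of `log A` given `A ≠ 0` is arithmetic with span `h`. -/
def CondLogArithSpan {Ω : Type*} [MeasurableSpace Ω] (P : Measure Ω) (A : Ω → ℝ)
    (h : ℝ) : Prop :=
  0 < h ∧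
  P {ω | A ω ≠ 0 ∧ ∀ k : ℤ, Real.log (A ω) ≠ (k : ℝ) * h} = 0 ∧
  ∀ h' : ℝ, 0 < h' →
    P {ω | A ω ≠ 0 ∧ ∀ k : ℤ, Real.log (A ω) ≠ (k : ℝ) * h'} = 0 → h' ≤ h

/-- The exponentially tilted distribution of `log A`: the measure `C ↦ E[1{log A ∈ C} A^κ]`
(the integrand vanishing on `{A = 0}` since `κ > 0`); it has total mass `E A^κ = θ`. -/
def tiltedLog {Ω : Type*} [MeasurableSpace Ω] (P : Measure Ω) (A : Ω → ℝ)
    (κ : ℝ) : Measure ℝ :=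
  Measure.map (fun ω => Real.log (A ω)) (P.withDensity fun ω => ENNReal.ofReal (A ω ^ κ))

/-- The normalized tilted distribution, with distribution function
`F_κ(x) = θ⁻¹ E[1{log A ≤ x} A^κ]`. -/
def normTilted {Ω : Type*} [MeasurableSpace Ω] (P : Measure Ω) (A : Ω → ℝ)
    (κ θ : ℝ) : Measure ℝ :=
  (ENNReal.ofReal θ)⁻¹ • tiltedLog P A κ

/-- Convolution of two measures on `ℝ`. -/
def mconv (μ ν : Measure ℝ) : Measure ℝ :=
  Measure.map (fun p : ℝ × ℝ => p.1 + p.2) (μ.prod ν)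

/-- The point masses `p_k = F_κ(kh) - F_κ(kh-)` of the normalized tilted distribution. -/
def pA3 {Ω : Type*} [MeasurableSpace Ω] (P : Measure Ω) (A : Ω → ℝ)
    (κ θ h : ℝ) (k : ℤ) : ℝ :=
  (normTilted P A κ θ (Set.Iic ((k : ℝ) * h))).toReal -
    (normTilted P A κ θ (Set.Iio ((k : ℝ) * h))).toReal

/-- The point masses `p_k^{*2} = (F_κ*F_κ)(kh) - (F_κ*F_κ)(kh-)`. -/
def p2A3 {Ω : Type*} [MeasurableSpace Ω] (P : Measure Ω) (A : Ω → ℝ)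
    (κ θ h : ℝ) (k : ℤ) : ℝ :=
  (mconv (normTilted P A κ θ) (normTilted P A κ θ) (Set.Iic ((k : ℝ) * h))).toReal -
    (mconv (normTilted P A κ θ) (normTilted P A κ θ) (Set.Iio ((k : ℝ) * h))).toReal

/-- Assumption (A3): `A ≥ 0` a.s., `E A^κ = θ ∈ (0,1)`, `log A | A ≠ 0` arithmetic with
span `h`, the normalized tilted distribution function `F_κ` is `h`-subexponential
(`p_{n+1}/p_n → 1` and `p_n^{*2}/p_n → 2`), and `sup_{k ≥ n} p_k = O(p_n)`. -/
def AssumptionA3 {Ω : Type*} [MeasurableSpace Ω] (P : Measure Ω) (A : Ω → ℝ)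
    (κ θ h : ℝ) : Prop :=
  0 < κ ∧ 0 < θ ∧ θ < 1 ∧ (∀ᵐ ω ∂P, 0 ≤ A ω) ∧ (∫ ω, A ω ^ κ ∂P) = θ ∧
  CondLogArithSpan P A h ∧
  Tendsto (fun n : ℕ => pA3 P A κ θ h (n + 1) / pA3 P A κ θ h n) atTop (𝓝 1) ∧
  Tendsto (fun n : ℕ => p2A3 P A κ θ h n / pA3 P A κ θ h n) atTop (𝓝 2) ∧
  ∃ C : ℝ, ∀ᶠ n : ℕ in atTop, ∀ k : ℕ, n ≤ k → pA3 P A κ θ h k ≤ C * pA3 P A κ θ h n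

/-- Convolution of two functions on `ℤ`. -/
def latticeConv (p g : ℤ → ℝ) (n : ℤ) : ℝ := ∑' k : ℤ, p (n - k) * g k

/-- A probability mass function on `ℤ` that is subexponential at `+∞`, with
`sup_{k ≥ n} p k = O(p n)`. -/
structure LatticeSubexp (p : ℤ → ℝ) : Prop where
  nonneg : ∀ k, 0 ≤ p k
  hasSum_one : HasSum p 1
  ratio : Tendsto (fun n : ℤ => p (n + 1) / p n) atTop (𝓝 1)
  conv_self : Tendsto (fun n : ℤ => latticeConv p p n / p n) atTop (𝓝 2)
  dominated : ∃ C : ℝ, ∀ᶠ n : ℤ in atTop, ∀ k : ℤ, n ≤ k → p k ≤ C * p n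

namespace LatticeSubexp

variable {p : ℤ → ℝ}

theorem le_one (hp : LatticeSubexp p) (k : ℤ) : p k ≤ 1 :=
  le_hasSum hp.hasSum_one k fun j _ => hp.nonneg j

theorem eventually_pos (hp : LatticeSubexp p) : ∀ᶠ n : ℤ in atTop, 0 < p n := by
  filter_upwards [hp.ratio.eventually_ne one_ne_zero] with n hn
  refine lt_of_le_of_ne (hp.nonneg n) fun h => hn ?_
  rw [← h, div_zero]

theorem summable_conv (hp : LatticeSubexp p) {g : ℤ → ℝ} (hg : Summable g) (n : ℤ) :
    Summable fun k : ℤ => p (n - k) * g k := by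
  refine Summable.of_norm_bounded hg.norm fun k => ?_
  rw [norm_mul, Real.norm_of_nonneg (hp.nonneg _)]
  exact mul_le_of_le_one_left (norm_nonneg _) (hp.le_one _)

theorem hasSum_reflect (hp : LatticeSubexp p) (n : ℤ) :
    HasSum (fun k : ℤ => p (n - k)) 1 :=
  ((Equiv.subLeft n).hasSum_iff (f := p)).2 hp.hasSum_one

theorem tendsto_add_nat (hp : LatticeSubexp p) (k : ℕ) :
    Tendsto (fun n : ℤ => p (n + k) / p n) atTop (𝓝 1) := by
  induction k with
  | zero =>
    refine tendsto_const_nhds.congr' ?_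
    filter_upwards [hp.eventually_pos] with n hn
    simp [hn.ne']
  | succ k ih =>
    have hshift : Tendsto (fun n : ℤ => n + (k : ℤ)) atTop atTop :=
      tendsto_atTop_add_const_right _ _ tendsto_id
    have h := (hp.ratio.comp hshift).mul ih
    rw [one_mul] at h
    refine h.congr' ?_
    filter_upwards [hp.eventually_pos, hshift.eventually hp.eventually_pos] with n hn hn'
    simp only [Function.comp_apply, Nat.cast_succ, ← add_assoc]
    field_simp

theorem tendsto_sub (hp : LatticeSubexp p) (k : ℤ) :
    Tendsto (fun n : ℤ => p (n - k) / p n) atTop (𝓝 1) := by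
  obtain ⟨m, rfl | rfl⟩ := k.eq_nat_or_neg
  · have hshift : Tendsto (fun n : ℤ => n - (m : ℤ)) atTop atTop := by
      simpa only [sub_eq_add_neg, id] using
        tendsto_atTop_add_const_right atTop (-(m : ℤ)) tendsto_id
    have h := ((hp.tendsto_add_nat m).comp hshift).inv₀ one_ne_zero
    simpa [Function.comp_def] using h
  · simpa using hp.tendsto_add_nat m

/-- Convolving with a summable function supported on a left half-line. -/
theorem tendsto_conv_of_support (hp : LatticeSubexp p) {g : ℤ → ℝ} (hg : Summable g) {K : ℤ}
    (hK : ∀ k, K < k → g k = 0) :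
    Tendsto (fun n : ℤ => latticeConv p g n / p n) atTop (𝓝 (∑' k, g k)) := by
  obtain ⟨C, hC⟩ := hp.dominated
  have hshift : Tendsto (fun n : ℤ => n - K) atTop atTop := by
    simpa only [sub_eq_add_neg, id] using tendsto_atTop_add_const_right atTop (-K) tendsto_id
  have key : Tendsto (fun n : ℤ => ∑' k, p (n - k) / p n * g k) atTop (𝓝 (∑' k, g k)) := by
    refine tendsto_tsum_of_dominated_convergence (bound := fun k => |C| * 2 * |g k|)
      (hg.abs.mul_left _) (fun k => ?_) ?_
    · simpa using (hp.tendsto_sub k).mul_const (g k)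
    · filter_upwards [hshift.eventually hC, hp.eventually_pos,
        (hp.tendsto_sub K).eventually_le_const (show (1 : ℝ) < 2 by norm_num)] with n hn hpos hn2 k
      rw [Real.norm_eq_abs, abs_mul]
      by_cases hk : K < k
      · simp [hK k hk]
      · have h1 := hn (n - k) (by lia)
        rw [abs_of_nonneg (div_nonneg (hp.nonneg _) (hp.nonneg _))]
        refine mul_le_mul_of_nonneg_right ?_ (abs_nonneg _)
        calc p (n - k) / p n ≤ |C| * p (n - K) / p n := by
              gcongr
              exact h1.trans (mul_le_mul_of_nonneg_right (le_abs_self C) (hp.nonneg _))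
          _ = |C| * (p (n - K) / p n) := by ring
          _ ≤ |C| * 2 := by gcongr
  refine key.congr fun n => ?_
  rw [latticeConv, ← tsum_div_const]
  exact tsum_congr fun k => by ring

theorem conv_split {g : ℤ → ℝ} {n : ℤ}
    (hg : Summable fun k : ℤ => p (n - k) * g k) (K : ℤ) :
    latticeConv p g n = latticeConv p ((Set.Iic K).indicator g) n
      + latticeConv p ((Set.Ioi K).indicator g) n := by
  have e (s : Set ℤ) : (fun k => p (n - k) * s.indicator g k)
      = s.indicator fun k => p (n - k) * g k := by
    ext k
    by_cases hk : k ∈ s <;> simp [hk]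
  simp only [latticeConv, e]
  rw [← (hg.indicator _).tsum_add (hg.indicator _)]
  refine tsum_congr fun k => ?_
  by_cases hk : k ≤ K
  · simp [hk]
  · simp [hk, not_le.1 hk]

theorem tsum_split {g : ℤ → ℝ} (hg : Summable g) (K : ℤ) :
    ∑' k, g k = ∑' k, (Set.Iic K).indicator g k + ∑' k, (Set.Ioi K).indicator g k := by
  rw [← (hg.indicator _).tsum_add (hg.indicator _)]
  refine tsum_congr fun k => ?_
  by_cases hk : k ≤ K
  · simp [hk]
  · simp [hk, not_le.1 hk]

/-- The contribution to `p * p` of summands beyond `K`. -/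
theorem tendsto_conv_tail (hp : LatticeSubexp p) (K : ℤ) :
    Tendsto (fun n : ℤ => latticeConv p ((Set.Ioi K).indicator p) n / p n) atTop
      (𝓝 (1 + ∑' k, (Set.Ioi K).indicator p k)) := by
  have hs := hp.hasSum_one.summable
  have h := hp.conv_self.sub (hp.tendsto_conv_of_support (hs.indicator (Set.Iic K)) (K := K)
    fun k hk => by simp [hk])
  have h1 := tsum_split hs K
  rw [hp.hasSum_one.tsum_eq] at h1
  convert h using 2 with n
  · rw [conv_split (hp.summable_conv hs n) K]
    ring
  · linarith

theorem tendsto_tail (hp : LatticeSubexp p) :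
    Tendsto (fun K : ℤ => ∑' k, (Set.Ioi K).indicator p k) atTop (𝓝 0) := by
  rw [← tsum_zero (α := ℝ) (β := ℤ)]
  refine tendsto_tsum_of_dominated_convergence (bound := p) hp.hasSum_one.summable
    (fun k => ?_) (Eventually.of_forall fun K k => ?_)
  · refine tendsto_const_nhds.congr' ?_
    filter_upwards [eventually_ge_atTop k] with K hK
    simp [hK]
  · rw [Real.norm_of_nonneg (Set.indicator_nonneg (fun j _ => hp.nonneg j) k)]
    exact Set.indicator_le_self' (fun _ _ => hp.nonneg _) k

/-- Convolution with `p` does not enlarge the eventual bound on `d / p`, up to the total mass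
of `d`. -/
theorem eventually_conv_sub_le (hp : LatticeSubexp p) {d : ℤ → ℝ} (hd : Summable d) {E η : ℝ}
    (hE : 0 < E) (hη : 0 < η) (hdE : ∀ᶠ k in atTop, |d k| ≤ E * p k) :
    ∀ᶠ n in atTop, |latticeConv p d n / p n - ∑' k, d k| ≤ E + η := by
  obtain ⟨K₀, hK₀⟩ := eventually_atTop.1 hdE
  obtain ⟨K, hK, hτ⟩ := ((eventually_ge_atTop K₀).and
    (hp.tendsto_tail.eventually_lt_const (show 0 < η / (2 * E) by positivity))).exists
  set τ := ∑' k, (Set.Ioi K).indicator p k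
  have hps := hp.hasSum_one.summable
  have hdR (k : ℤ) : |(Set.Ioi K).indicator d k| ≤ E * (Set.Ioi K).indicator p k := by
    by_cases hk : K < k
    · simpa [hk] using hK₀ k (by lia)
    · simp [hk]
  have hR : |∑' k, (Set.Ioi K).indicator d k| ≤ E * τ := by
    rw [← tsum_mul_left, ← Real.norm_eq_abs]
    exact tsum_of_norm_bounded (((hps.indicator _).mul_left E).hasSum) hdR
  have hL := hp.tendsto_conv_of_support (hd.indicator (Set.Iic K)) (K := K)
    fun k hk => by simp [hk]
  have hlim := (((hL.sub_const (∑' k, (Set.Iic K).indicator d k)).abs.add_const (E * τ)).add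
    ((hp.tendsto_conv_tail K).const_mul E))
  have hlt : |∑' k, (Set.Iic K).indicator d k - ∑' k, (Set.Iic K).indicator d k| + E * τ
      + E * (1 + τ) < E + η := by
    rw [lt_div_iff₀ (by positivity)] at hτ
    rw [sub_self, abs_zero]
    linarith
  filter_upwards [hlim.eventually_lt_const hlt, hp.eventually_pos] with n hn hpos
  refine le_trans ?_ hn.le
  rw [conv_split (hp.summable_conv hd n) K, tsum_split hd K]
  have hc : |latticeConv p ((Set.Ioi K).indicator d) n / p n|
      ≤ E * (latticeConv p ((Set.Ioi K).indicator p) n / p n) := by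
    rw [abs_div, abs_of_pos hpos, ← mul_div_assoc]
    gcongr
    rw [latticeConv, latticeConv, ← tsum_mul_left, ← Real.norm_eq_abs]
    refine tsum_of_norm_bounded
      (((hp.summable_conv (hps.indicator _) n).mul_left E).hasSum) fun k => ?_
    rw [norm_mul, Real.norm_of_nonneg (hp.nonneg _), mul_left_comm]
    exact mul_le_mul_of_nonneg_left (hdR k) (hp.nonneg _)
  rw [abs_le] at *
  have := neg_abs_le (latticeConv p ((Set.Iic K).indicator d) n / p n
    - ∑' k, (Set.Iic K).indicator d k)
  have := le_abs_self (latticeConv p ((Set.Iic K).indicator d) n / p n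
    - ∑' k, (Set.Iic K).indicator d k)
  rw [add_div]
  constructor <;> linarith [hc.1, hc.2, hR.1, hR.2]

theorem summable_exp_indicator_Iic {l : ℝ} (hl : 0 < l) (K : ℤ) :
    Summable ((Set.Iic K).indicator fun k : ℤ => Real.exp (l * k)) := by
  refine Summable.of_nat_of_neg ?_ ?_
  · refine summable_of_hasFiniteSupport ((Set.finite_Iic K.toNat).subset fun n hn => ?_)
    have : (n : ℤ) ≤ K := by
      by_contra h
      simp [h] at hn
    simp only [Set.mem_Iic]
    lia
  · have hgeo : Summable fun n : ℕ => Real.exp (-l) ^ n :=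
      summable_geometric_of_lt_one (Real.exp_pos _).le (Real.exp_lt_one_iff.2 (by linarith))
    refine Summable.of_nonneg_of_le
      (fun n => Set.indicator_nonneg (fun _ _ => (Real.exp_pos _).le) _) (fun n => ?_) hgeo
    refine (Set.indicator_le_self' (fun _ _ => (Real.exp_pos _).le) _).trans_eq ?_
    rw [← Real.exp_nat_mul]
    push_cast
    ring_nf

/-- A solution of the renewal equation which is small compared with `exp (l * n)` at `+∞` is
`O(p)`. -/
theorem eventually_le_of_renewal (hp : LatticeSubexp p) {f ψ : ℤ → ℝ} {θ l c₀ : ℝ}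
    (hθ0 : 0 < θ) (hθ1 : θ < 1) (hl : 0 < l)
    (hw : Summable fun k : ℤ => p k * Real.exp (-(l * k)))
    (hw1 : θ * ∑' k : ℤ, p k * Real.exp (-(l * k)) ≤ 1)
    (hf0 : ∀ n, 0 ≤ f n) (hfl : ∀ n : ℤ, f n ≤ c₀ * Real.exp (l * n))
    (hft : Tendsto (fun n : ℤ => f n / Real.exp (l * n)) atTop (𝓝 0))
    (heq : ∀ n, f n = ψ n + θ * latticeConv p f n)
    (hψ : Tendsto (fun n => ψ n / p n) atTop (𝓝 0)) :
    ∃ M : ℝ, 0 ≤ M ∧ ∀ᶠ n in atTop, f n ≤ M * p n := by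
  have hps := hp.hasSum_one.summable
  have hc₀ : 0 ≤ c₀ := by simpa using (hf0 0).trans (hfl 0)
  have hexp (n k : ℤ) : p (n - k) * Real.exp (l * k)
      = Real.exp (l * n) * (p (n - k) * Real.exp (-(l * (n - k : ℤ)))) := by
    rw [mul_left_comm, ← Real.exp_add]
    push_cast
    ring_nf
  have hsexp (n : ℤ) : HasSum (fun k : ℤ => p (n - k) * Real.exp (l * k))
      (Real.exp (l * n) * ∑' k : ℤ, p k * Real.exp (-(l * k))) := by
    simp only [hexp]
    exact (((Equiv.subLeft n).hasSum_iff
      (f := fun k : ℤ => p k * Real.exp (-(l * k)))).2 hw.hasSum).mul_left _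
  have hsf (n : ℤ) : Summable fun k : ℤ => p (n - k) * f k := by
    refine Summable.of_nonneg_of_le (fun k => mul_nonneg (hp.nonneg _) (hf0 k)) (fun k => ?_)
      ((hsexp n).summable.mul_left c₀)
    rw [mul_left_comm]
    exact mul_le_mul_of_nonneg_left (hfl k) (hp.nonneg _)
  obtain ⟨ρ, hρ1, hρ⟩ : ∃ ρ : ℝ, 1 < ρ ∧ θ * ρ < 1 := by
    refine ⟨(1 + 1 / θ) / 2, ?_, ?_⟩
    · have := (one_lt_div hθ0).2 hθ1
      linarith
    · field_simp
      linarith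
  obtain ⟨K₀, hK₀⟩ := eventually_atTop.1 hp.eventually_pos
  obtain ⟨K, hKK, hτ⟩ := ((eventually_ge_atTop K₀).and
    (hp.tendsto_tail.eventually_lt_const (show 0 < ρ - 1 by linarith))).exists
  have hpos (k : ℤ) (hk : K ≤ k) : 0 < p k := hK₀ k (hKK.trans hk)
  have hfLs : Summable ((Set.Iic K).indicator f) := by
    refine Summable.of_nonneg_of_le (fun k => Set.indicator_nonneg (fun j _ => hf0 j) k)
      (fun k => ?_) ((summable_exp_indicator_Iic hl K).mul_left c₀)
    by_cases hk : k ≤ K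
    · simpa [hk] using hfl k
    · simp [hk]
  have hleft : ∃ c₁, ∀ᶠ n in atTop,
      ψ n + θ * latticeConv p ((Set.Iic K).indicator f) n ≤ c₁ * p n := by
    have h := hψ.add ((hp.tendsto_conv_of_support hfLs (K := K)
      fun k hk => by simp [hk]).const_mul θ)
    refine ⟨0 + θ * ∑' k, (Set.Iic K).indicator f k + 1, ?_⟩
    filter_upwards [h.eventually_lt_const (lt_add_one _), hp.eventually_pos] with n hn hn'
    rw [← mul_div_assoc, ← add_div, div_lt_iff₀ hn'] at hn
    exact hn.le
  obtain ⟨c₁, hc₁⟩ := hleft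
  obtain ⟨n₀, hn₀⟩ := eventually_atTop.1 (hc₁.and
    ((hp.tendsto_conv_tail K).eventually_lt_const (show _ < ρ by linarith)))
  set M : ℝ := ∑ k ∈ Finset.Ioo K n₀, f k / p k + |c₁| / (1 - θ * ρ)
  have hsum0 (k : ℤ) (_ : k ∈ Finset.Ioo K n₀) : 0 ≤ f k / p k :=
    div_nonneg (hf0 k) (hp.nonneg k)
  have hq0 : 0 ≤ |c₁| / (1 - θ * ρ) := div_nonneg (abs_nonneg _) (by linarith)
  have hM0 : 0 ≤ M := add_nonneg (Finset.sum_nonneg hsum0) hq0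
  have hMc : c₁ + θ * ρ * M ≤ M := by
    have h1 : |c₁| / (1 - θ * ρ) ≤ M := le_add_of_nonneg_left (Finset.sum_nonneg hsum0)
    rw [div_le_iff₀ (by linarith)] at h1
    linarith [le_abs_self c₁]
  have hbound (ε : ℝ) (hε : 0 < ε) : ∃ c : ℝ, 0 ≤ c ∧
      ∀ k : ℤ, f k ≤ ε * Real.exp (l * k) + c := by
    obtain ⟨N, hN⟩ := eventually_atTop.1 (hft.eventually_lt_const hε)
    refine ⟨c₀ * Real.exp (l * N), by positivity, fun k => ?_⟩
    rcases le_total N k with hk | hk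
    · have h1 := hN k hk
      rw [div_lt_iff₀ (Real.exp_pos _)] at h1
      have : 0 ≤ c₀ * Real.exp (l * N) := by positivity
      linarith
    · have h1 : c₀ * Real.exp (l * k) ≤ c₀ * Real.exp (l * N) := by gcongr
      have : 0 ≤ ε * Real.exp (l * k) := by positivity
      linarith [hfl k]
  have hiter (ε : ℝ) (hε : 0 < ε) (c : ℝ) (hc : 0 ≤ c)
      (hb : ∀ k : ℤ, f k ≤ ε * Real.exp (l * k) + c) (m : ℕ) :
      ∀ n : ℤ, K < n → f n ≤ M * p n + ε * Real.exp (l * n) + c * θ ^ m := by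
    induction m with
    | zero =>
      intro n _
      have := mul_nonneg hM0 (hp.nonneg n)
      linarith [hb n]
    | succ m ih =>
      intro n hn
      rcases lt_or_ge n n₀ with hnn | hnn
      · have h1 : f n / p n ≤ M := by
          have := Finset.single_le_sum hsum0 (Finset.mem_Ioo.2 ⟨hn, hnn⟩)
          linarith
        rw [div_le_iff₀ (hpos n hn.le)] at h1
        have : 0 ≤ ε * Real.exp (l * n) := by positivity
        have : 0 ≤ c * θ ^ (m + 1) := by positivity
        linarith
      · obtain ⟨h1, h2⟩ := hn₀ n hnn
        rw [div_lt_iff₀ (hpos n hn.le)] at h2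
        have h3 : latticeConv p ((Set.Ioi K).indicator f) n
            ≤ M * latticeConv p ((Set.Ioi K).indicator p) n
              + ε * (Real.exp (l * n) * ∑' k : ℤ, p k * Real.exp (-(l * k)))
              + c * θ ^ m * 1 := by
          have hs := (((hp.summable_conv (hps.indicator (Set.Ioi K)) n).hasSum.mul_left M).add
            ((hsexp n).mul_left ε)).add ((hp.hasSum_reflect n).mul_left (c * θ ^ m))
          have hsR : Summable fun k => p (n - k) * (Set.Ioi K).indicator f k := by
            refine ((hsf n).indicator (Set.Ioi K)).congr fun k => ?_
            by_cases hk : K < k <;> simp [hk]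
          refine hasSum_le (fun k => ?_) hsR.hasSum hs
          have hq := hp.nonneg (n - k)
          by_cases hk : K < k
          · have := mul_le_mul_of_nonneg_left (ih k hk) hq
            simp only [Set.indicator_of_mem (Set.mem_Ioi.2 hk)]
            linarith
          · simp only [Set.indicator_of_notMem (show k ∉ Set.Ioi K from hk), mul_zero, zero_add]
            positivity
        have h4 : f n ≤ c₁ * p n + θ * latticeConv p ((Set.Ioi K).indicator f) n := by
          rw [heq n, conv_split (hsf n) K]
          linarith
        have h5 := mul_le_mul_of_nonneg_left h3 hθ0.le
        have h6 := mul_le_mul_of_nonneg_left h2.le (mul_nonneg hθ0.le hM0)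
        have h7 := mul_le_mul_of_nonneg_left hw1
          (mul_nonneg hε.le (Real.exp_pos (l * n)).le)
        have h8 := mul_le_mul_of_nonneg_right hMc (hp.nonneg n)
        rw [pow_succ]
        linarith
  refine ⟨M, hM0, ?_⟩
  filter_upwards [eventually_gt_atTop K] with n hn
  have hε (ε : ℝ) (hε : 0 < ε) : f n ≤ M * p n + ε * Real.exp (l * n) := by
    obtain ⟨c, hc, hb⟩ := hbound ε hε
    have hlim : Tendsto (fun m : ℕ => M * p n + ε * Real.exp (l * n) + c * θ ^ m) atTop
        (𝓝 (M * p n + ε * Real.exp (l * n) + c * 0)) :=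
      ((tendsto_pow_atTop_nhds_zero_of_lt_one hθ0.le hθ1).const_mul c).const_add _
    rw [mul_zero, add_zero] at hlim
    exact ge_of_tendsto' hlim fun m => hiter ε hε c hc hb m n hn
  refine le_of_forall_pos_le_add fun ε hε' => ?_
  have := hε (ε / Real.exp (l * n)) (by positivity)
  rwa [div_mul_cancel₀ _ (Real.exp_pos _).ne'] at this

/-- Renewal theorem on `ℤ` for subexponential increments: bounded comparison with `p` upgrades
to convergence. -/
theorem tendsto_of_renewal (hp : LatticeSubexp p) {f ψ : ℤ → ℝ} {θ M : ℝ}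
    (hθ0 : 0 < θ) (hθ1 : θ < 1) (hf : Summable f) (hfM : ∀ᶠ n in atTop, |f n| ≤ M * p n)
    (heq : ∀ n, f n = ψ n + θ * latticeConv p f n)
    (hψ : Tendsto (fun n => ψ n / p n) atTop (𝓝 0)) :
    Tendsto (fun n => f n / p n) atTop (𝓝 (θ * (∑' k, f k) / (1 - θ))) := by
  set a := θ * (∑' k, f k) / (1 - θ) with ha
  have ha' : a = θ * (∑' k, f k) + θ * a := by
    rw [ha]
    field_simp [(by linarith : (1 - θ) ≠ 0)]
    ring
  have hps := hp.hasSum_one.summable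
  set d : ℤ → ℝ := fun k => f k - a * p k with hd
  have hds : Summable d := hf.sub (hps.mul_left a)
  have hdsum : ∑' k, d k = ∑' k, f k - a := by
    rw [hd, hf.tsum_sub (hps.mul_left a), tsum_mul_left, hp.hasSum_one.tsum_eq, mul_one]
  have hconv (n : ℤ) : latticeConv p f n = latticeConv p d n + a * latticeConv p p n := by
    simp only [latticeConv]
    rw [← tsum_mul_left, ← (hp.summable_conv hds n).tsum_add ((hp.summable_conv hps n).mul_left a)]
    exact tsum_congr fun k => by simp only [hd]; ring
  have herr : Tendsto (fun n => ψ n / p n + θ * a * (latticeConv p p n / p n - 2)) atTop (𝓝 0) := by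
    simpa using hψ.add ((hp.conv_self.sub_const 2).const_mul (θ * a))
  have hdeq : ∀ᶠ n in atTop, d n / p n = (ψ n / p n + θ * a * (latticeConv p p n / p n - 2))
      + θ * (latticeConv p d n / p n - ∑' k, d k) := by
    filter_upwards [hp.eventually_pos] with n hn
    have h1 : d n / p n = f n / p n - a := by
      simp only [hd]
      field_simp
    rw [h1, heq n, hconv n, hdsum]
    have h2 : (ψ n + θ * (latticeConv p d n + a * latticeConv p p n)) / p n
      = ψ n / p n + θ * (latticeConv p d n / p n) + θ * a * (latticeConv p p n / p n) := by ring
    rw [h2]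
    linarith
  have hstep (E : ℝ) (hE : 0 < E) (h : ∀ᶠ n in atTop, |d n| ≤ E * p n) :
      ∀ᶠ n in atTop, |d n| ≤ (1 + θ) / 2 * E * p n := by
    have hη : 0 < (1 - θ) * E / 4 := by
      have : 0 < 1 - θ := by linarith
      positivity
    filter_upwards [hp.eventually_conv_sub_le hds hE hη h, hdeq, hp.eventually_pos,
      herr.eventually (Metric.ball_mem_nhds 0 hη)] with n h1 h2 hn h3
    rw [dist_zero_right, Real.norm_eq_abs] at h3
    rw [← div_le_iff₀ hn]
    refine (congrArg (|d n| / ·) (abs_of_pos hn).symm).trans_le ?_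
    rw [← abs_div, h2]
    refine (abs_add_le _ _).trans ?_
    rw [abs_mul, abs_of_pos hθ0]
    have h4 := mul_le_mul_of_nonneg_left h1 hθ0.le
    have h5 := mul_le_mul_of_nonneg_right hθ1.le hη.le
    linarith
  have hiter (m : ℕ) : ∀ᶠ n in atTop, |d n| ≤ ((1 + θ) / 2) ^ m * (|M| + |a| + 1) * p n := by
    induction m with
    | zero =>
      filter_upwards [hfM] with n hn
      have h1 : |d n| ≤ |f n| + |a| * p n := by
        refine (abs_sub _ _).trans_eq ?_
        rw [abs_mul, abs_of_nonneg (hp.nonneg n)]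
      have h2 := mul_le_mul_of_nonneg_right (le_abs_self M) (hp.nonneg n)
      linarith [hp.nonneg n]
    | succ m ih =>
      filter_upwards [hstep _ (by positivity) ih] with n hn
      rwa [pow_succ', mul_assoc ((1 + θ) / 2)]
  have hd0 : Tendsto (fun n => d n / p n) atTop (𝓝 0) := by
    rw [Metric.tendsto_nhds]
    intro ε hε
    have hgeo := (tendsto_pow_atTop_nhds_zero_of_lt_one (r := (1 + θ) / 2) (by linarith)
      (by linarith)).mul_const (|M| + |a| + 1)
    rw [zero_mul] at hgeo
    obtain ⟨m, hm⟩ := (hgeo.eventually_lt_const hε).exists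
    filter_upwards [hiter m, hp.eventually_pos] with n hn hpos
    rw [dist_zero_right, Real.norm_eq_abs, abs_div, abs_of_pos hpos, div_lt_iff₀ hpos]
    exact hn.trans_lt (mul_lt_mul_of_pos_right hm hpos)
  have := hd0.add_const a
  rw [zero_add] at this
  refine this.congr' ?_
  filter_upwards [hp.eventually_pos] with n hn
  simp only [hd]
  field_simp
  ring

/-- Renewal theorem on `ℤ` for subexponential increments. -/
theorem exists_tendsto_of_renewal (hp : LatticeSubexp p) {f ψ : ℤ → ℝ} {θ l c₀ : ℝ}
    (hθ0 : 0 < θ) (hθ1 : θ < 1) (hl : 0 < l)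
    (hw : Summable fun k : ℤ => p k * Real.exp (-(l * k)))
    (hw1 : θ * ∑' k : ℤ, p k * Real.exp (-(l * k)) ≤ 1)
    (hf0 : ∀ n, 0 ≤ f n) (hfl : ∀ n : ℤ, f n ≤ c₀ * Real.exp (l * n))
    (hft : Tendsto (fun n : ℤ => f n / Real.exp (l * n)) atTop (𝓝 0))
    (heq : ∀ n, f n = ψ n + θ * latticeConv p f n)
    (hψ : Tendsto (fun n => ψ n / p n) atTop (𝓝 0)) :
    ∃ a, Tendsto (fun n => f n / p n) atTop (𝓝 a) := by
  obtain ⟨M, hM0, hM⟩ := hp.eventually_le_of_renewal hθ0 hθ1 hl hw hw1 hf0 hfl hft heq hψ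
  obtain ⟨K, hK⟩ := eventually_atTop.1 hM
  have hf : Summable f := by
    refine Summable.of_nonneg_of_le hf0 (fun k => ?_)
      (((summable_exp_indicator_Iic hl K).mul_left c₀).add (hp.hasSum_one.summable.mul_left M))
    by_cases hk : k ≤ K
    · have := mul_nonneg hM0 (hp.nonneg k)
      simpa [hk] using (hfl k).trans (le_add_of_nonneg_right this)
    · simpa [hk] using hK k (by lia)
  exact ⟨_, hp.tendsto_of_renewal hθ0 hθ1 hf
    (hM.mono fun n hn => by rwa [abs_of_nonneg (hf0 n)]) heq hψ⟩

end LatticeSubexp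

open scoped Pointwise in
/-- Pointwise limits of nonincreasing functions on a dense set, with a scaling relation, extend to
a nonincreasing limit profile. -/
theorem exists_limit_profile {g : ℕ → ℝ → ℝ} {c γ : ℝ} (hc : 0 < c) (hγ : 0 ≤ γ)
    (hg0 : ∀ n x, 0 < x → 0 ≤ g n x) (hanti : ∀ n, AntitoneOn (g n) (Set.Ioi 0))
    (hdense : ∀ a b, 0 ≤ a → a < b → ∃ d ∈ Set.Ioo a b, ∃ l, Tendsto (g · d) atTop (𝓝 l))
    (hscale : ∀ d l, 0 < d →
      (Tendsto (g · d) atTop (𝓝 l) ↔ Tendsto (g · (d * c)) atTop (𝓝 (γ * l))))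
    (hγ0 : γ ≠ 0) :
    ∃ Q : ℝ → ℝ, (∀ x, 0 < x → 0 ≤ Q x) ∧ AntitoneOn Q (Set.Ioi 0) ∧
      (∀ x, 0 < x → Q (x * c) = γ * Q x) ∧
      ∀ x, 0 < x → ContinuousAt Q x → Tendsto (g · x) atTop (𝓝 (Q x)) := by
  set S : ℝ → Set ℝ := fun x => {l | ∃ d, 0 < d ∧ d ≤ x ∧ Tendsto (g · d) atTop (𝓝 l)}
  have hS0 (x l : ℝ) (hl : l ∈ S x) : 0 ≤ l := by
    obtain ⟨d, hd, -, h⟩ := hl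
    exact ge_of_tendsto' h fun n => hg0 n d hd
  have hbdd (x : ℝ) : BddBelow (S x) := ⟨0, fun l hl => hS0 x l hl⟩
  have hne (x : ℝ) (hx : 0 < x) : (S x).Nonempty := by
    obtain ⟨d, hd, l, hl⟩ := hdense 0 x le_rfl hx
    exact ⟨l, d, hd.1, hd.2.le, hl⟩
  refine ⟨fun x => sInf (S x), fun x hx => le_csInf (hne x hx) (hS0 x), ?_, fun x hx => ?_,
    fun x hx hcont => ?_⟩
  · intro x hx y hy hxy
    exact csInf_le_csInf (hbdd y) (hne x hx) fun l ⟨d, h1, h2, h3⟩ => ⟨d, h1, h2.trans hxy, h3⟩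
  · have hset : S (x * c) = γ • S x := by
      ext l
      rw [Set.mem_smul_set]
      constructor
      · rintro ⟨d, hd, hdx, hl⟩
        refine ⟨γ⁻¹ * l, ⟨d / c, by positivity, (div_le_iff₀ hc).2 hdx, ?_⟩, ?_⟩
        · rw [hscale _ _ (by positivity), div_mul_cancel₀ _ hc.ne', mul_inv_cancel_left₀ hγ0]
          exact hl
        · rw [smul_eq_mul, mul_inv_cancel_left₀ hγ0]
      · rintro ⟨l, ⟨d, hd, hdx, hl⟩, rfl⟩
        exact ⟨d * c, by positivity, by gcongr, (hscale d l hd).1 hl⟩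
    simp only [hset]
    exact Real.sInf_smul_of_nonneg hγ _
  · rw [tendsto_order]
    constructor
    · intro a ha
      obtain ⟨ε, hε, hball⟩ := Metric.eventually_nhds_iff.1 (hcont.eventually_const_lt ha)
      have hx2 : a < sInf (S (x + ε / 2)) := hball (by
        rw [Real.dist_eq, add_sub_cancel_left, abs_of_pos (by positivity)]; linarith)
      obtain ⟨d, hd, l, hl⟩ := hdense x (x + ε / 2) hx.le (by linarith)
      have hd0 : 0 < d := hx.trans hd.1
      have hal : a < l := hx2.trans_le (csInf_le (hbdd _) ⟨d, hd0, hd.2.le, hl⟩)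
      filter_upwards [hl.eventually_const_lt hal] with n hn
      exact hn.trans_le (hanti n hx hd0 hd.1.le)
    · intro a ha
      obtain ⟨ε, hε, hball⟩ := Metric.eventually_nhds_iff.1 (hcont.eventually_lt_const ha)
      obtain ⟨y, hy, hyx⟩ := exists_between (max_lt hx (show x - ε < x by linarith))
      have hy0 : 0 < y := (le_max_left _ _).trans_lt hy
      have hyε : x - ε < y := (le_max_right _ _).trans_lt hy
      have hSy : sInf (S y) < a := hball (by
        rw [Real.dist_eq, abs_of_neg (by linarith)]; linarith)
      obtain ⟨d, hd, l, hl⟩ := hdense y x hy0.le hyx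
      have hd0 : 0 < d := hy0.trans hd.1
      have hla : l < a := by
        refine lt_of_le_of_lt (le_csInf (hne y hy0) ?_) hSy
        rintro l' ⟨d', hd', hdy, hl'⟩
        exact le_of_tendsto_of_tendsto' hl hl' fun n => hanti n hd' hd0 (hdy.trans hd.1.le)
      filter_upwards [hl.eventually_lt_const hla] with n hn
      exact (hanti n hd0 hx hd.2.le).trans_lt hn

/-- Along geometric sequences, an integrable function decays for almost every starting point. -/
theorem ae_tendsto_geometric {F : ℝ → ℝ} (hF : IntegrableOn F (Set.Ioi 0)) {h η : ℝ}
    (hη : 0 < η) :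
    ∀ᵐ x : ℝ, 0 < x → Tendsto (fun n : ℕ =>
      Real.exp (-(η * n)) * Real.exp (n * h) * F (x * Real.exp (n * h))) atTop (𝓝 0) := by
  set Fn : ℕ → ℝ → ℝ := fun n x =>
    Real.exp (-(η * n)) * Real.exp (n * h) * F (x * Real.exp (n * h))
  have hFn (n : ℕ) : IntegrableOn (Fn n) (Set.Ioi 0) := by
    refine Integrable.const_mul ?_ _
    rw [← IntegrableOn, integrableOn_Ioi_comp_mul_right_iff F 0 (Real.exp_pos _), zero_mul]
    exact hF
  have hnorm (n : ℕ) : ∫ x in Set.Ioi (0 : ℝ), ‖Fn n x‖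
      = Real.exp (-η) ^ n * ∫ x in Set.Ioi (0 : ℝ), ‖F x‖ := by
    have h1 := integral_comp_mul_right_Ioi (fun x => ‖F x‖) 0 (Real.exp_pos (n * h))
    simp only [Fn, norm_mul, Real.norm_of_nonneg (Real.exp_pos _).le]
    rw [integral_const_mul, h1, zero_mul, smul_eq_mul, ← Real.exp_nat_mul]
    field_simp
  have hsum : Summable fun n : ℕ => ∫ x in Set.Ioi (0 : ℝ), ‖Fn n x‖ := by
    simp only [hnorm]
    exact (summable_geometric_of_lt_one (Real.exp_pos _).le
      (Real.exp_lt_one_iff.2 (by linarith))).mul_right _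
  have hfin : ∫⁻ x in Set.Ioi (0 : ℝ), ∑' n, ‖Fn n x‖ₑ ≠ ⊤ := by
    rw [lintegral_tsum fun n => (hFn n).aestronglyMeasurable.enorm]
    have : ∀ n, ∫⁻ x in Set.Ioi (0 : ℝ), ‖Fn n x‖ₑ
        = ENNReal.ofReal (∫ x in Set.Ioi (0 : ℝ), ‖Fn n x‖) := fun n =>
      (ofReal_integral_norm_eq_lintegral_enorm (hFn n)).symm
    simp only [this]
    exact hsum.tsum_ofReal_ne_top
  have hae := ae_lt_top' (AEMeasurable.tsum fun n =>
    (hFn n).aestronglyMeasurable.enorm) hfin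
  rw [ae_restrict_iff' measurableSet_Ioi] at hae
  filter_upwards [hae] with x hx hx0
  have h1 := ENNReal.tendsto_atTop_zero_of_tsum_ne_top (hx hx0).ne
  have h2 := (ENNReal.tendsto_toReal ENNReal.zero_ne_top).comp h1
  simp only [ENNReal.toReal_zero, Function.comp_def, toReal_enorm] at h2
  exact tendsto_zero_iff_norm_tendsto_zero.2 h2

theorem hasSum_measureReal_iUnion {α : Type*} [MeasurableSpace α] (μ : Measure α)
    [IsFiniteMeasure μ] {s : ℤ → Set α} (hs : ∀ k, MeasurableSet (s k))
    (hd : Pairwise (Function.onFun Disjoint s)) :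
    HasSum (fun k => μ.real (s k)) (μ.real (⋃ k, s k)) := by
  have h := measure_iUnion (μ := μ) hd hs
  rw [measureReal_def, h]
  have hne : ∑' k, μ (s k) ≠ ⊤ := h ▸ measure_ne_top _ _
  rw [ENNReal.tsum_toReal_eq fun k => measure_ne_top _ _]
  exact ENNReal.hasSum_toReal hne

theorem measureReal_Iic_sub_Iio (μ : Measure ℝ) [IsFiniteMeasure μ] (a : ℝ) :
    (μ (Set.Iic a)).toReal - (μ (Set.Iio a)).toReal = μ.real {a} := by
  rw [← measureReal_def, ← measureReal_def, ← Set.Iio_union_right,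
    measureReal_union (by simp) (measurableSet_singleton a)]
  ring

/-- Point masses of a convolution of lattice measures. -/
theorem mconv_singleton {μ : Measure ℝ} [IsFiniteMeasure μ] {h : ℝ} (hh : 0 < h)
    (hμ : μ {x | ∀ k : ℤ, x ≠ k * h} = 0) (n : ℤ) :
    (mconv μ μ).real {n * h} = ∑' k : ℤ, μ.real {(n - k : ℤ) * h} * μ.real {k * h} := by
  have hinj {j k : ℤ} (e : (j : ℝ) * h = k * h) : j = k := by
    exact_mod_cast mul_right_cancel₀ hh.ne' e
  have hpre : (mconv μ μ).real {n * h} = (μ.prod μ).real {p : ℝ × ℝ | p.1 + p.2 = n * h} := by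
    rw [mconv, measureReal_def, Measure.map_apply (by fun_prop) (measurableSet_singleton _)]
    rfl
  have hae : ({p : ℝ × ℝ | p.1 + p.2 = n * h} : Set (ℝ × ℝ)) =ᵐ[μ.prod μ]
      ⋃ k : ℤ, ({(n - k : ℤ) * h} : Set ℝ) ×ˢ ({k * h} : Set ℝ) := by
    have h0 : ∀ᵐ y ∂μ, ∃ k : ℤ, y = k * h := by
      rw [ae_iff]
      simpa using hμ
    filter_upwards [Measure.quasiMeasurePreserving_snd.ae h0] with p hp
    refine propext ?_
    obtain ⟨k, hk⟩ := hp
    change p.1 + p.2 = n * h ↔ p ∈ ⋃ k : ℤ, ({(n - k : ℤ) * h} : Set ℝ) ×ˢ ({k * h} : Set ℝ)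
    simp only [Set.mem_iUnion, Set.mem_prod, Set.mem_singleton_iff]
    constructor
    · intro e
      refine ⟨k, ?_, hk⟩
      push_cast
      linarith
    · rintro ⟨j, h1, h2⟩
      rw [h1, h2]
      push_cast
      ring
  rw [hpre, measureReal_congr hae]
  rw [← (hasSum_measureReal_iUnion (μ.prod μ)
    (fun k => (measurableSet_singleton _).prod (measurableSet_singleton _)) ?_).tsum_eq]
  · exact tsum_congr fun k => measureReal_prod_prod _ _
  · intro j k hjk
    refine Set.disjoint_left.2 fun p hp hp' => hjk (hinj ?_)
    rw [← hp.2, ← hp'.2]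

section Tilted

variable {Ω : Type*} [MeasurableSpace Ω] {P : Measure Ω} {A : Ω → ℝ} {κ θ h : ℝ}

theorem lintegral_ofReal_rpow (hA0 : ∀ᵐ ω ∂P, 0 ≤ A ω) (hθ : 0 < θ)
    (hθA : ∫ ω, A ω ^ κ ∂P = θ) : ∫⁻ ω, ENNReal.ofReal (A ω ^ κ) ∂P = ENNReal.ofReal θ := by
  rw [← hθA, ofReal_integral_eq_lintegral_ofReal]
  · exact Integrable.of_integral_ne_zero (hθA ▸ hθ.ne')
  · filter_upwards [hA0] with ω hω using Real.rpow_nonneg hω κ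

theorem isProbabilityMeasure_normTilted (hA : Measurable A) (hA0 : ∀ᵐ ω ∂P, 0 ≤ A ω)
    (hθ : 0 < θ) (hθA : ∫ ω, A ω ^ κ ∂P = θ) : IsProbabilityMeasure (normTilted P A κ θ) := by
  refine ⟨?_⟩
  rw [normTilted, Measure.smul_apply, tiltedLog,
    Measure.map_apply hA.log MeasurableSet.univ, Set.preimage_univ,
    withDensity_apply _ MeasurableSet.univ, Measure.restrict_univ,
    lintegral_ofReal_rpow hA0 hθ hθA, smul_eq_mul]
  exact ENNReal.inv_mul_cancel (by simpa using hθ) ENNReal.ofReal_ne_top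

theorem normTilted_lattice (hA : Measurable A)
    (hlat : P {ω | A ω ≠ 0 ∧ ∀ k : ℤ, Real.log (A ω) ≠ k * h} = 0) :
    normTilted P A κ θ {x | ∀ k : ℤ, x ≠ k * h} = 0 := by
  have hm : MeasurableSet {x : ℝ | ∀ k : ℤ, x ≠ k * h} := by
    simp only [Set.ofPred_forall]
    exact MeasurableSet.iInter fun k => (measurableSet_singleton _).compl
  rw [normTilted, Measure.smul_apply, tiltedLog,
    Measure.map_apply hA.log hm, smul_eq_mul, mul_eq_zero]
  refine Or.inr (withDensity_absolutelyContinuous _ _ (measure_mono_null ?_ hlat))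
  refine fun ω hω => ⟨fun h0 => ?_, hω⟩
  have := hω 0
  simp [h0] at this

theorem normTilted_singleton (hA : Measurable A) (hA0 : ∀ᵐ ω ∂P, 0 ≤ A ω) (hκ : 0 < κ)
    (hθ : 0 < θ) (x : ℝ) :
    (normTilted P A κ θ).real {x}
      = θ⁻¹ * Real.exp (κ * x) * P.real {ω | A ω = Real.exp x} := by
  have hm : MeasurableSet {ω | A ω = Real.exp x} := hA (measurableSet_singleton _)
  have hm' : MeasurableSet ((fun ω => Real.log (A ω)) ⁻¹' {x}) :=
    hA.log (measurableSet_singleton _)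
  have key : tiltedLog P A κ {x} = ENNReal.ofReal (Real.exp (κ * x)) * P {ω | A ω = Real.exp x} := by
    rw [tiltedLog, Measure.map_apply hA.log (measurableSet_singleton _),
      withDensity_apply _ hm', ← lintegral_indicator hm', ← lintegral_indicator_const hm]
    refine lintegral_congr_ae ?_
    filter_upwards [hA0] with ω hω
    rcases hω.eq_or_lt with h0 | hpos
    · have : ω ∉ {ω | A ω = Real.exp x} := fun e => (Real.exp_pos x).ne (h0.trans e)
      rw [Set.indicator_of_notMem this]
      simp [Set.indicator, ← h0, Real.zero_rpow hκ.ne']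
    · by_cases e : A ω = Real.exp x
      · have h1 : ω ∈ (fun ω => Real.log (A ω)) ⁻¹' {x} := by simp [e]
        rw [Set.indicator_of_mem h1, Set.indicator_of_mem (show ω ∈ {ω | A ω = Real.exp x} from e),
          e, ← Real.exp_mul, mul_comm]
      · have h1 : ω ∉ (fun ω => Real.log (A ω)) ⁻¹' {x} := by
          rintro rfl
          exact e (Real.exp_log hpos).symm
        rw [Set.indicator_of_notMem h1,
          Set.indicator_of_notMem (show ω ∉ {ω | A ω = Real.exp x} from e)]
  rw [measureReal_def, normTilted, Measure.smul_apply, key, smul_eq_mul, ENNReal.toReal_mul,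
    ENNReal.toReal_inv, ENNReal.toReal_mul, ENNReal.toReal_ofReal hθ.le,
    ENNReal.toReal_ofReal (Real.exp_pos _).le, ← measureReal_def, mul_assoc]

theorem pA3_eq (hA : Measurable A) (hA0 : ∀ᵐ ω ∂P, 0 ≤ A ω) (hθ : 0 < θ)
    (hθA : ∫ ω, A ω ^ κ ∂P = θ) (k : ℤ) :
    pA3 P A κ θ h k = (normTilted P A κ θ).real {k * h} := by
  have := isProbabilityMeasure_normTilted hA hA0 hθ hθA
  exact measureReal_Iic_sub_Iio _ _

theorem latticeSubexp_pA3 (hA : Measurable A) (hA3 : AssumptionA3 P A κ θ h) :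
    LatticeSubexp (pA3 P A κ θ h) := by
  obtain ⟨hκ, hθ, -, hA0, hθA, ⟨hh, hlat, -⟩, hr, h2, C, hC⟩ := hA3
  have := isProbabilityMeasure_normTilted hA hA0 hθ hθA
  have hp := pA3_eq (h := h) hA hA0 hθ hθA
  have hsupp := normTilted_lattice (κ := κ) (θ := θ) hA hlat
  refine ⟨fun k => hp k ▸ measureReal_nonneg, ?_, ?_, ?_, C, ?_⟩
  · have hs := hasSum_measureReal_iUnion (normTilted P A κ θ) (s := fun k : ℤ => {k * h})
      (fun k => measurableSet_singleton _) (fun j k hjk => by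
        refine Set.disjoint_singleton.2 fun e => hjk ?_
        exact_mod_cast mul_right_cancel₀ hh.ne' e)
    have huniv : (normTilted P A κ θ).real (⋃ k : ℤ, {k * h}) = 1 := by
      rw [← probReal_univ (μ := normTilted P A κ θ)]
      refine measureReal_congr ?_
      have h0 : ∀ᵐ y ∂(normTilted P A κ θ), ∃ k : ℤ, y = k * h := by
        rw [ae_iff]
        simpa using hsupp
      filter_upwards [h0] with y hy
      exact propext (iff_of_true (Set.mem_iUnion.2 hy) trivial)
    rw [huniv] at hs
    exact hs.congr_fun hp
  · rw [← Nat.map_cast_int_atTop, tendsto_map'_iff]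
    exact hr
  · rw [← Nat.map_cast_int_atTop, tendsto_map'_iff]
    refine h2.congr fun n => ?_
    have hconv : p2A3 P A κ θ h n = latticeConv (pA3 P A κ θ h) (pA3 P A κ θ h) n := by
      have : IsFiniteMeasure (mconv (normTilted P A κ θ) (normTilted P A κ θ)) := by
        unfold mconv
        infer_instance
      refine (measureReal_Iic_sub_Iio _ _).trans ((mconv_singleton hh hsupp n).trans ?_)
      exact tsum_congr fun k => by rw [hp, hp]
    simp only [Function.comp_apply, hconv]
  · rw [← Nat.map_cast_int_atTop, eventually_map]
    filter_upwards [hC] with n hn k hk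
    lift k to ℕ using by lia
    exact hn k (by exact_mod_cast hk)

theorem hasSum_measureReal_mul_gt [IsFiniteMeasure P] {X : Ω → ℝ} (hA : Measurable A)
    (hX : Measurable X) (hA0 : ∀ᵐ ω ∂P, 0 ≤ A ω) (hh : 0 < h)
    (hlat : P {ω | A ω ≠ 0 ∧ ∀ k : ℤ, Real.log (A ω) ≠ k * h} = 0)
    (hindep : IndepFun A X P) {y : ℝ} (hy : 0 < y) :
    HasSum (fun k : ℤ => P.real {ω | A ω = Real.exp (k * h)}
      * P.real {ω | y * Real.exp (-(k * h)) < X ω}) (P.real {ω | y < A ω * X ω}) := by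
  have hmA (k : ℤ) : MeasurableSet {ω | A ω = Real.exp (k * h)} := hA (measurableSet_singleton _)
  have hmX (z : ℝ) : MeasurableSet {ω | z < X ω} := hX measurableSet_Ioi
  have hs := hasSum_measureReal_iUnion P (s := fun k : ℤ => {ω | A ω = Real.exp (k * h)}
    ∩ {ω | y * Real.exp (-(k * h)) < X ω}) (fun k => (hmA k).inter (hmX _)) (fun j k hjk => by
      refine Set.disjoint_left.2 fun ω hω hω' => hjk ?_
      have := Real.exp_injective (hω.1.symm.trans hω'.1)
      exact_mod_cast mul_right_cancel₀ hh.ne' this)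
  have hae : P.real {ω | y < A ω * X ω} = P.real (⋃ k : ℤ, {ω | A ω = Real.exp (k * h)}
      ∩ {ω | y * Real.exp (-(k * h)) < X ω}) := by
    refine measureReal_congr ?_
    have h0 : ∀ᵐ ω ∂P, ¬(A ω ≠ 0 ∧ ∀ k : ℤ, Real.log (A ω) ≠ k * h) := by
      rw [ae_iff]
      simpa only [not_not] using hlat
    filter_upwards [hA0, h0] with ω hω hω'
    refine propext ?_
    change y < A ω * X ω ↔ ω ∈ ⋃ k : ℤ, {ω | A ω = Real.exp (k * h)}
      ∩ {ω | y * Real.exp (-(k * h)) < X ω}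
    simp only [Set.mem_iUnion, Set.mem_inter_iff, Set.mem_ofPred_eq]
    have hiff (k : ℤ) (e : A ω = Real.exp (k * h)) :
        y < A ω * X ω ↔ y * Real.exp (-(k * h)) < X ω := by
      rw [e, Real.exp_neg, ← div_eq_mul_inv, div_lt_iff₀ (Real.exp_pos _), mul_comm]
    constructor
    · intro hyA
      have hne : A ω ≠ 0 := fun e => by
        rw [e, zero_mul] at hyA
        exact hy.not_gt hyA
      push Not at hω'
      obtain ⟨k, hk⟩ := hω' hne
      have e : A ω = Real.exp (k * h) := by
        rw [← hk, Real.exp_log (lt_of_le_of_ne hω hne.symm)]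
      exact ⟨k, e, (hiff k e).1 hyA⟩
    · rintro ⟨k, e, hk⟩
      exact (hiff k e).2 hk
  rw [hae]
  refine hs.congr_fun fun k => ?_
  have := hindep.measure_inter_preimage_eq_mul {Real.exp (k * h)}
    (Set.Ioi (y * Real.exp (-(k * h)))) (measurableSet_singleton _) measurableSet_Ioi
  have h2 := congrArg ENNReal.toReal this
  rw [ENNReal.toReal_mul] at h2
  exact h2.symm

end Tilted

theorem LatticeSubexp.tendsto_exp_div {p : ℤ → ℝ} (hp : LatticeSubexp p) {η : ℝ} (hη : 0 < η) :
    Tendsto (fun n : ℕ => Real.exp (-(η * n)) / p n) atTop (𝓝 0) := by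
  have hpos := tendsto_natCast_atTop_atTop.eventually hp.eventually_pos
  refine (summable_of_ratio_test_tendsto_lt_one (l := Real.exp (-η))
    (Real.exp_lt_one_iff.2 (by linarith)) ?_ ?_).tendsto_atTop_zero
  · filter_upwards [hpos] with n hn using (div_pos (Real.exp_pos _) hn).ne'
  · have h := ((hp.ratio.comp tendsto_natCast_atTop_atTop).inv₀ one_ne_zero).const_mul
      (Real.exp (-η))
    rw [inv_one, mul_one] at h
    refine h.congr' ?_
    filter_upwards [hpos, (tendsto_add_atTop_nat 1).eventually hpos] with n hn hn'
    have e : Real.exp (-(η * (n + 1 : ℕ))) = Real.exp (-η) * Real.exp (-(η * n)) := by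
      rw [← Real.exp_add]
      push_cast
      ring_nf
    push_cast at hn'
    simp only [Function.comp_apply, norm_div, Real.norm_of_nonneg (Real.exp_pos _).le]
    rw [e, Nat.cast_succ, Real.norm_of_nonneg hn.le, Real.norm_of_nonneg hn'.le]
    field_simp

/-- Convergence of the rescaled tail along one geometric sequence. -/
theorem exists_tendsto_tail {Ω : Type*} [MeasurableSpace Ω] {P : Measure Ω}
    [IsProbabilityMeasure P] {A X : Ω → ℝ} {κ θ h : ℝ} (hA : Measurable A) (hX : Measurable X)
    (hA3 : AssumptionA3 P A κ θ h) (hindep : IndepFun A X P) {δ x : ℝ} (hδ : 0 < δ) (hx : 0 < x)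
    (hlim : Tendsto (fun n : ℕ => Real.exp (-(δ / 2 * h * n)) * Real.exp (n * h) *
      ((x * Real.exp (n * h)) ^ (κ + δ - 1) * |P.real {ω | x * Real.exp (n * h) < X ω}
        - P.real {ω | x * Real.exp (n * h) < A ω * X ω}|)) atTop (𝓝 0)) :
    ∃ a, Tendsto (fun n : ℕ => (pA3 P A κ θ h n)⁻¹ * Real.exp (κ * (n * h))
      * P.real {ω | x * Real.exp (n * h) < X ω}) atTop (𝓝 a) := by
  have hp := latticeSubexp_pA3 hA hA3
  obtain ⟨hκ, hθ, hθ1, hA0, hθA, ⟨hh, hlat, -⟩, -⟩ := hA3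
  set p := pA3 P A κ θ h with hpdef
  have hw (k : ℤ) : P.real {ω | A ω = Real.exp (k * h)}
      = θ * (p k * Real.exp (-(κ * h * k))) := by
    rw [hpdef, pA3_eq hA hA0 hθ hθA, normTilted_singleton hA hA0 hκ hθ, Real.exp_neg,
      show κ * (k * h) = κ * h * k by ring]
    field_simp
  have hwsum := hasSum_measureReal_iUnion P (s := fun k : ℤ => {ω | A ω = Real.exp (k * h)})
    (fun k => hA (measurableSet_singleton _)) (fun j k hjk => by
      refine Set.disjoint_left.2 fun ω hω hω' => hjk ?_
      have := Real.exp_injective (hω.symm.trans hω')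
      exact_mod_cast mul_right_cancel₀ hh.ne' this)
  simp only [hw] at hwsum
  have hws : Summable fun k : ℤ => p k * Real.exp (-(κ * h * k)) :=
    (summable_mul_left_iff hθ.ne').1 hwsum.summable
  have hw1 : θ * ∑' k : ℤ, p k * Real.exp (-(κ * h * k)) ≤ 1 := by
    rw [← tsum_mul_left, hwsum.tsum_eq]
    exact measureReal_le_one
  set f : ℤ → ℝ := fun n => x ^ κ * Real.exp (κ * h * n)
    * P.real {ω | x * Real.exp (n * h) < X ω} with hf
  set ψ : ℤ → ℝ := fun n => x ^ κ * Real.exp (κ * h * n)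
    * (P.real {ω | x * Real.exp (n * h) < X ω} - P.real {ω | x * Real.exp (n * h) < A ω * X ω})
    with hψ
  have hxκ : 0 < x ^ κ := Real.rpow_pos_of_pos hx κ
  have hren (n : ℤ) : f n = ψ n + θ * latticeConv p f n := by
    have hs := (hasSum_measureReal_mul_gt hA hX hA0 hh hlat hindep
      (y := x * Real.exp (n * h)) (by positivity)).mul_left (x ^ κ * Real.exp (κ * h * n))
    have hconv : x ^ κ * Real.exp (κ * h * n)
        * P.real {ω | x * Real.exp (n * h) < A ω * X ω} = θ * latticeConv p f n := by
      rw [← hs.tsum_eq, latticeConv, ← tsum_mul_left, ← (Equiv.subLeft n).tsum_eq]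
      refine tsum_congr fun k => ?_
      have e1 : x * Real.exp (n * h) * Real.exp (-((n - k : ℤ) * h)) = x * Real.exp (k * h) := by
        rw [mul_assoc, ← Real.exp_add]
        push_cast
        ring_nf
      have e2 : Real.exp (κ * h * n) * Real.exp (-(κ * h * (n - k : ℤ)))
          = Real.exp (κ * h * k) := by
        rw [← Real.exp_add]
        push_cast
        ring_nf
      rw [Equiv.subLeft_apply, hw, e1]
      simp only [hf]
      rw [← e2]
      ring
    rw [← hconv]
    simp only [hf, hψ]
    ring
  have hgeom : Tendsto (fun n : ℤ => x * Real.exp (n * h)) atTop atTop :=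
    (Real.tendsto_exp_atTop.comp (tendsto_intCast_atTop_atTop.atTop_mul_const hh)).const_mul_atTop hx
  have htail : Tendsto (fun n : ℤ => f n / Real.exp (κ * h * n)) atTop (𝓝 0) := by
    have h1 : Tendsto (fun y : ℝ => P.real {ω | y < X ω}) atTop (𝓝 0) := by
      have : IsProbabilityMeasure (P.map X) := Measure.isProbabilityMeasure_map hX.aemeasurable
      have h2 := (tendsto_cdf_atTop (P.map X)).const_sub 1
      rw [sub_self] at h2
      refine h2.congr fun y => ?_
      rw [cdf_eq_real, ← probReal_compl_eq_one_sub measurableSet_Iic, Set.compl_Iic,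
        map_measureReal_apply hX measurableSet_Ioi]
      rfl
    have h2 := (h1.comp hgeom).const_mul (x ^ κ)
    rw [mul_zero] at h2
    refine h2.congr fun n => ?_
    simp only [hf, Function.comp_apply]
    field_simp
  have hψlim : Tendsto (fun n => ψ n / p n) atTop (𝓝 0) := by
    rw [← Nat.map_cast_int_atTop, tendsto_map'_iff, tendsto_zero_iff_norm_tendsto_zero]
    have h1 := ((hlim.mul (hp.tendsto_exp_div (show 0 < δ / 2 * h by positivity))).const_mul
      (x ^ (1 - δ)))
    simp only [mul_zero] at h1
    refine h1.congr fun n => ?_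
    simp only [Function.comp_apply, hψ, norm_div, norm_mul,
      Real.norm_of_nonneg (hp.nonneg _), Real.norm_of_nonneg hxκ.le,
      Real.norm_of_nonneg (Real.exp_pos _).le, Real.norm_eq_abs, Int.cast_natCast]
    rw [Real.mul_rpow hx.le (Real.exp_pos _).le, ← Real.exp_mul]
    have e1 : x ^ κ = x ^ (1 - δ) * x ^ (κ + δ - 1) := by
      rw [← Real.rpow_add hx]
      ring_nf
    have e2 : Real.exp (κ * h * n) = Real.exp (-(δ / 2 * h * n)) * Real.exp (n * h)
        * Real.exp (n * h * (κ + δ - 1)) * Real.exp (-(δ / 2 * h * n)) := by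
      simp only [← Real.exp_add]
      ring_nf
    rw [e1, e2]
    ring
  obtain ⟨a, ha⟩ := hp.exists_tendsto_of_renewal (f := f) hθ hθ1 (mul_pos hκ hh) hws hw1
    (fun n => by simp only [hf]; positivity)
    (fun n => mul_le_of_le_one_right (by positivity) measureReal_le_one) htail hren hψlim
  refine ⟨a / x ^ κ, ((ha.comp tendsto_natCast_atTop_atTop).div_const (x ^ κ)).congr fun n => ?_⟩
  simp only [Function.comp_apply, hf, Int.cast_natCast]
  rw [show κ * (n * h) = κ * h * n by ring]
  field_simp

/-- Theorem 7 (implicit renewal theorem beyond the Cramér condition): under (A3) and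
the `δ`-integrability condition, there is `q ∈ 𝒬(κ,h)` with
`p_n⁻¹ x^κ e^{κnh} P(X > x e^{nh}) → q(x)` at every continuity point `x > 0` of `q`. -/
theorem stmt11 {Ω : Type*} [MeasurableSpace Ω] (P : Measure Ω) [IsProbabilityMeasure P]
    (A X : Ω → ℝ) (hAmeas : Measurable A) (hXmeas : Measurable X)
    (κ θ h : ℝ) (hA3 : AssumptionA3 P A κ θ h)
    (hindep : IndepFun A X P)
    (hint : ∃ δ : ℝ, 0 < δ ∧ IntegrableOn
      (fun y : ℝ => y ^ (κ + δ - 1) *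
        |(P {ω | X ω > y}).toReal - (P {ω | A ω * X ω > y}).toReal|)
      (Set.Ioi (0 : ℝ))) :
    ∃ q : ℝ → ℝ, MemQ κ h q ∧
      ∀ x : ℝ, 0 < x → ContinuousAt q x →
        Tendsto (fun n : ℕ =>
            (pA3 P A κ θ h n)⁻¹ * x ^ κ * Real.exp (κ * (n * h)) *
              (P {ω | X ω > x * Real.exp (n * h)}).toReal)
          atTop (𝓝 (q x)) := by
  obtain ⟨δ, hδ, hint⟩ := hint
  have hp := latticeSubexp_pA3 hAmeas hA3
  obtain ⟨hκ, -, -, -, -, ⟨hh, -⟩, -⟩ := id hA3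
  set p := pA3 P A κ θ h
  set g : ℕ → ℝ → ℝ := fun n x =>
    (p n)⁻¹ * Real.exp (κ * (n * h)) * P.real {ω | x * Real.exp (n * h) < X ω} with hg
  have hpnat : ∀ᶠ n : ℕ in atTop, 0 < p n :=
    tendsto_natCast_atTop_atTop.eventually hp.eventually_pos
  have hpinv (n : ℕ) : 0 ≤ (p n)⁻¹ := inv_nonneg.2 (hp.nonneg _)
  have hstep : ∀ᶠ n : ℕ in atTop, ∀ d, g n (d * Real.exp h)
      = p (n + 1) / p n * (Real.exp (-κ * h) * g (n + 1) d) := by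
    filter_upwards [hpnat, (tendsto_add_atTop_nat 1).eventually hpnat] with n hn hn' d
    push_cast at hn'
    have e1 : d * Real.exp h * Real.exp (n * h) = d * Real.exp ((n + 1) * h) := by
      rw [mul_assoc, ← Real.exp_add]
      ring_nf
    have e2 : Real.exp (κ * (n * h)) = Real.exp (-κ * h) * Real.exp (κ * ((n + 1) * h)) := by
      rw [← Real.exp_add]
      ring_nf
    simp only [hg, e1, e2, Nat.cast_add, Nat.cast_one]
    field_simp
  have hratio : Tendsto (fun n : ℕ => p (n + 1) / p n) atTop (𝓝 1) :=
    hp.ratio.comp tendsto_natCast_atTop_atTop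
  have hanti (n : ℕ) : AntitoneOn (g n) (Set.Ioi 0) := by
    intro x _ y _ hxy
    have hsub : {ω | y * Real.exp (n * h) < X ω} ⊆ {ω | x * Real.exp (n * h) < X ω} := by
      intro ω hω
      exact (mul_le_mul_of_nonneg_right hxy (Real.exp_pos _).le).trans_lt hω
    exact mul_le_mul_of_nonneg_left (measureReal_mono hsub)
      (mul_nonneg (hpinv n) (Real.exp_pos _).le)
  have hdense (a b : ℝ) (ha : 0 ≤ a) (hab : a < b) :
      ∃ d ∈ Set.Ioo a b, ∃ l, Tendsto (g · d) atTop (𝓝 l) := by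
    obtain ⟨d, hd, hdab⟩ := (Measure.dense_of_ae
      (ae_tendsto_geometric hint (h := h) (show 0 < δ / 2 * h by positivity))).exists_between hab
    have hd0 : 0 < d := ha.trans_lt hdab.1
    exact ⟨d, hdab, exists_tendsto_tail hAmeas hXmeas hA3 hindep hδ hd0 (hd hd0)⟩
  have hscale (d l : ℝ) (_ : 0 < d) : Tendsto (g · d) atTop (𝓝 l) ↔
      Tendsto (g · (d * Real.exp h)) atTop (𝓝 (Real.exp (-κ * h) * l)) := by
    rw [← tendsto_add_atTop_iff_nat (f := (g · d)) 1]
    constructor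
    · intro hl
      have h1 := hratio.mul (hl.const_mul (Real.exp (-κ * h)))
      rw [one_mul] at h1
      exact h1.congr' (hstep.mono fun n hn => (hn d).symm)
    · intro hl
      have h1 := ((hratio.inv₀ one_ne_zero).mul hl).const_mul (Real.exp (-κ * h))⁻¹
      rw [inv_one, one_mul, inv_mul_cancel_left₀ (Real.exp_pos _).ne'] at h1
      refine h1.congr' ?_
      filter_upwards [hstep, hpnat, (tendsto_add_atTop_nat 1).eventually hpnat] with n hn hn1 hn2
      push_cast at hn2
      rw [hn d]
      field_simp
  obtain ⟨Q, hQ0, hQanti, hQper, hQlim⟩ := exists_limit_profile (Real.exp_pos h)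
    (Real.exp_pos (-κ * h)).le (fun n x _ => mul_nonneg (mul_nonneg (hpinv n) (Real.exp_pos _).le)
      measureReal_nonneg) hanti hdense hscale (Real.exp_pos _).ne'
  have hcancel {x : ℝ} (hx : 0 < x) : x ^ (-κ) * (x ^ κ * Q x) = Q x := by
    rw [← mul_assoc, ← Real.rpow_add hx, neg_add_cancel, Real.rpow_zero, one_mul]
  refine ⟨fun x => x ^ κ * Q x, ⟨fun x hx => mul_nonneg (Real.rpow_nonneg hx.le _) (hQ0 x hx),
    fun x hx y hy hxy => ?_, fun x hx => ?_⟩, fun x hx hcont => ?_⟩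
  · simpa only [hcancel hx, hcancel hy] using hQanti hx hy hxy
  · have e : Real.exp h ^ κ * Real.exp (-κ * h) = 1 := by
      rw [← Real.exp_mul, ← Real.exp_add, ← Real.exp_zero]
      ring_nf
    beta_reduce
    rw [hQper x hx, Real.mul_rpow hx.le (Real.exp_pos _).le]
    linear_combination x ^ κ * Q x * e
  · have hQc : ContinuousAt Q x := by
      refine ((Real.continuousAt_rpow_const x (-κ) (Or.inl hx.ne')).mul hcont).congr ?_
      filter_upwards [eventually_gt_nhds hx] with y hy using hcancel hy
    refine ((hQlim x hx hQc).const_mul (x ^ κ)).congr fun n => ?_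
    simp only [measureReal_def, gt_iff_lt]
    ring
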